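/- arXiv:2310.00306 — 2 statements merged into one kernel-verified Lean document; each statement's English description precedes it below -/
import Mathlib

section
/- Let ν be monotone and of finite variation, and suppose the semivariation ν̃ satisfies condition (E). Let h, h_n : S → ℝ (n ∈ ℕ) satisfy sup{ |h(s)|, |h_n(s)| : s ∈ S, n ∈ ℕ } < ∞, and suppose h_n → h ν-almost everywhere, i.e. there exists E ∈ 𝒞 with ν(E) = 0 such that h_n(s) → h(s) for every s ∈ S∖E. Then lim_{n→∞} (|RL|)∫_S h_n dν = (|RL|)∫_S h dν. -/
open Filter Topology

/-- A countable partition of `E` (indexed by `ℕ`): pairwise disjoint measurable sets whose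
union is `E`.  Sets are allowed to be empty so that finite partitions are also included;
since `ν ∅ = 0`, empty pieces contribute nothing to the Riemann–Lebesgue sums. -/
def IsCtblePartition {S : Type*} [MeasurableSpace S] (E : Set S) (A : ℕ → Set S) : Prop :=
  (∀ n, MeasurableSet (A n)) ∧ Pairwise (Function.onFun Disjoint A) ∧ (⋃ n, A n) = E

/-- `P'` is finer than `P`: every set of `P'` is included in some set of `P`. -/
def FinerThan {S : Type*} (P P' : ℕ → Set S) : Prop := ∀ n, ∃ m, P' n ⊆ P m

/-- `t` is a choice of tags for the partition `P` : `t n ∈ P n` whenever `P n ≠ ∅`. -/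
def AreTags {S : Type*} (P : ℕ → Set S) (t : ℕ → S) : Prop := ∀ n, (P n).Nonempty → t n ∈ P n

/-- `h : S → X` is absolutely Riemann–Lebesgue `ν`-integrable on `E` with integral `a`:
for every `ε > 0` there is a countable partition `P₀` of `E` such that for every finer
countable partition `P = {A_n}` of `E`, `h` is bounded on every `A_n` with `ν (A_n) > 0`,
and for every choice of tags `s_n ∈ A_n` the series `Σ_n h (s_n) • ν (A_n)` converges
absolutely with `‖Σ_n h (s_n) • ν (A_n) - a‖ < ε`. -/
def AbsRL {S : Type*} [MeasurableSpace S] {X : Type*} [NormedAddCommGroup X] [NormedSpace ℝ X]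
    (ν : Set S → ℝ) (h : S → X) (E : Set S) (a : X) : Prop :=
  ∀ ε > 0, ∃ P₀ : ℕ → Set S, IsCtblePartition E P₀ ∧
    ∀ P : ℕ → Set S, IsCtblePartition E P → FinerThan P₀ P →
      (∀ n, 0 < ν (P n) → ∃ M, ∀ s ∈ P n, ‖h s‖ ≤ M) ∧
      ∀ t : ℕ → S, AreTags P t →
        Summable (fun n => ‖ν (P n) • h (t n)‖) ∧
        ‖(∑' n, ν (P n) • h (t n)) - a‖ < ε

/-- `h : S → X` is (unconditionally) Riemann–Lebesgue `ν`-integrable on `E` with integral `a`: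
as `AbsRL`, but the series is only required to converge unconditionally. -/
def RL {S : Type*} [MeasurableSpace S] {X : Type*} [NormedAddCommGroup X] [NormedSpace ℝ X]
    (ν : Set S → ℝ) (h : S → X) (E : Set S) (a : X) : Prop :=
  ∀ ε > 0, ∃ P₀ : ℕ → Set S, IsCtblePartition E P₀ ∧
    ∀ P : ℕ → Set S, IsCtblePartition E P → FinerThan P₀ P →
      (∀ n, 0 < ν (P n) → ∃ M, ∀ s ∈ P n, ‖h s‖ ≤ M) ∧
      ∀ t : ℕ → S, AreTags P t →
        Summable (fun n => ν (P n) • h (t n)) ∧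
        ‖(∑' n, ν (P n) • h (t n)) - a‖ < ε

/-- `h` is Birkhoff simple `ν`-integrable on `E` with integral `b`. -/
def BirkhoffSimple {S : Type*} [MeasurableSpace S] {X : Type*} [NormedAddCommGroup X]
    [NormedSpace ℝ X] (ν : Set S → ℝ) (h : S → X) (E : Set S) (b : X) : Prop :=
  ∀ ε > 0, ∃ P₀ : ℕ → Set S, IsCtblePartition E P₀ ∧
    ∀ P : ℕ → Set S, IsCtblePartition E P → FinerThan P₀ P →
      ∀ t : ℕ → S, AreTags P t →
        Filter.limsup (fun n => ‖(∑ k ∈ Finset.range (n + 1), ν (P k) • h (t k)) - b‖)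
          Filter.atTop < ε

/-- The set of all finite sums `Σ_i ν (A_i)` over finite pairwise disjoint families of
measurable sets contained in `E`. -/
def variationSet {S : Type*} [MeasurableSpace S] (ν : Set S → ℝ) (E : Set S) : Set ℝ :=
  { x | ∃ (k : ℕ) (A : Fin k → Set S), (∀ i, MeasurableSet (A i)) ∧ (∀ i, A i ⊆ E) ∧
        Pairwise (Function.onFun Disjoint A) ∧ x = ∑ i, ν (A i) }

/-- The variation `ν̄ (E)` of a set function `ν`. -/
noncomputable def variation {S : Type*} [MeasurableSpace S] (ν : Set S → ℝ) (E : Set S) : ℝ :=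
  sSup (variationSet ν E)

/-- `ν` is of finite variation (on `S`). -/
def FiniteVariation {S : Type*} [MeasurableSpace S] (ν : Set S → ℝ) : Prop :=
  BddAbove (variationSet ν Set.univ)

/-- The semivariation `ν̃ (A) = inf { ν̄ (B) : A ⊆ B, B measurable }`. -/
noncomputable def semivariation {S : Type*} [MeasurableSpace S] (ν : Set S → ℝ)
    (A : Set S) : ℝ :=
  sInf { x | ∃ B : Set S, MeasurableSet B ∧ A ⊆ B ∧ x = variation ν B }

/-- A finite partition of `E`, indexed by `Fin k` (pieces may be empty). -/
def IsFinPartition {S : Type*} [MeasurableSpace S] (E : Set S) {k : ℕ}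
    (A : Fin k → Set S) : Prop :=
  (∀ i, MeasurableSet (A i)) ∧ Pairwise (Function.onFun Disjoint A) ∧ (⋃ i, A i) = E

/-- `h` is Gould `ν`-integrable on `E` with integral `a`. -/
def Gould {S : Type*} [MeasurableSpace S] (ν : Set S → ℝ) (h : S → ℝ) (E : Set S)
    (a : ℝ) : Prop :=
  ∀ ε > 0, ∃ (k : ℕ) (P₀ : Fin k → Set S), IsFinPartition E P₀ ∧
    ∀ (l : ℕ) (P : Fin l → Set S), IsFinPartition E P → (∀ j, ∃ i, P j ⊆ P₀ i) →
      ∀ t : Fin l → S, (∀ j, (P j).Nonempty → t j ∈ P j) →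
        |(∑ j, ν (P j) * h (t j)) - a| < ε

/-- Condition (E) for a set function `μ` (defined at least on the measurable sets). -/
def ConditionE {S : Type*} [MeasurableSpace S] (μ : Set S → ℝ) : Prop :=
  ∀ B : ℕ → ℕ → Set S, (∀ m n, MeasurableSet (B m n)) →
    (∀ m, Antitone fun n => B m n) →
    μ (⋃ m, ⋂ n, B m n) = 0 →
    ∃ np mp : ℕ → ℕ, StrictMono np ∧ StrictMono mp ∧
      Filter.Tendsto (fun k => μ (⋃ p, ⋃ (_ : k ≤ p), B (mp p) (np p)))
        Filter.atTop (nhds 0)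

open scoped ENNReal
open MeasureTheory

/-- The fibres of `c` form a refinement of the partition into fibres of `d`. -/
def FiberRefines {S : Type*} (c d : S → ℕ) : Prop := ∀ s t, c s = c t → d s = d t

/-- The supremum of the sums of `N` over the traces on `A` of countable measurable partitions
of `S` (seen as fibres of maps to `ℕ`) that refine the fibres of `d`. -/
noncomputable def upperSum {S : Type*} [MeasurableSpace S] (N : Set S → ℝ≥0∞) (d : S → ℕ)
    (A : Set S) : ℝ≥0∞ :=
  ⨆ c : {c : S → ℕ // Measurable c ∧ FiberRefines c d}, ∑' n, N (c.1 ⁻¹' {n} ∩ A)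

/-- The upper limit, along refinement of countable measurable partitions of `S`, of the sums of
`N` over the traces on `A`. -/
noncomputable def upperLimit {S : Type*} [MeasurableSpace S] (N : Set S → ℝ≥0∞)
    (A : Set S) : ℝ≥0∞ :=
  ⨅ d : {d : S → ℕ // Measurable d}, upperSum N d.1 A

section UpperLimit

variable {S : Type*}

theorem preimage_pair_singleton (i : S → ℕ) (c : ℕ → S → ℕ) (k n : ℕ) :
    (fun s => Nat.pair (i s) (c (i s) s)) ⁻¹' {Nat.pair k n} = i ⁻¹' {k} ∩ c k ⁻¹' {n} := by
  ext s
  simp only [Set.mem_preimage, Set.mem_singleton_iff, Nat.pair_eq_pair, Set.mem_inter_iff]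
  constructor
  · rintro ⟨rfl, h⟩
    exact ⟨rfl, h⟩
  · rintro ⟨rfl, h⟩
    exact ⟨rfl, h⟩

theorem tsum_preimage_pair (N : Set S → ℝ≥0∞) (i : S → ℕ) (c : ℕ → S → ℕ) (A : Set S) :
    ∑' m, N ((fun s => Nat.pair (i s) (c (i s) s)) ⁻¹' {m} ∩ A) =
      ∑' k, ∑' n, N (c k ⁻¹' {n} ∩ (A ∩ i ⁻¹' {k})) := by
  rw [← Nat.pairEquiv.tsum_eq, ENNReal.tsum_prod']
  refine tsum_congr fun k => tsum_congr fun n => ?_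
  rw [Nat.pairEquiv_apply, Function.uncurry_apply_pair, preimage_pair_singleton]
  congr 1
  ext s
  simp only [Set.mem_inter_iff]
  tauto

theorem tsum_fiber_le {N : Set S → ℝ≥0∞} (hN0 : N ∅ = 0) {c d : S → ℕ} {A : Set S}
    (hcd : ∀ s ∈ A, ∀ t ∈ A, c s = c t → d s = d t) :
    ∑' n, N (c ⁻¹' {n} ∩ A) ≤ ∑' k, ∑' n, N (c ⁻¹' {n} ∩ (A ∩ d ⁻¹' {k})) := by
  rw [ENNReal.tsum_comm]
  refine ENNReal.tsum_le_tsum fun n => ?_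
  rcases (c ⁻¹' {n} ∩ A).eq_empty_or_nonempty with h | ⟨s, hs, hsA⟩
  · simp [h, hN0]
  · refine le_trans (le_of_eq ?_) (ENNReal.le_tsum (d s))
    congr 1
    ext t
    simp only [Set.mem_inter_iff, Set.mem_preimage, Set.mem_singleton_iff] at hs ⊢
    exact ⟨fun ht => ⟨ht.1, ht.2, hcd t ht.2 s hsA (ht.1.trans hs.symm)⟩,
      fun ht => ⟨ht.1, ht.2.1⟩⟩

variable [MeasurableSpace S]

theorem measurable_pair {i : S → ℕ} (hi : Measurable i) {c : ℕ → S → ℕ}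
    (hc : ∀ k, Measurable (c k)) : Measurable fun s => Nat.pair (i s) (c (i s) s) := by
  refine measurable_to_countable' fun m => ?_
  rw [← Nat.pair_unpair m, preimage_pair_singleton]
  exact (hi (measurableSet_singleton _)).inter (hc _ (measurableSet_singleton _))

theorem exists_measurable_index {f : ℕ → Set S} (hf : ∀ k, MeasurableSet (f k))
    (hd : Pairwise (Function.onFun Disjoint f)) :
    ∃ i : S → ℕ, Measurable i ∧ ∀ k, ∀ s ∈ f k, i s = k := by
  obtain ⟨i, hi, h⟩ := exists_measurable_piecewise f hf (fun k _ => k)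
    (fun _ => measurable_const) (fun j k hjk s hs =>
      absurd hs (Set.disjoint_left.1 (hd hjk) hs.1 |> fun h h' => h h'.2))
  exact ⟨i, hi, h⟩

theorem le_upperSum (N : Set S → ℝ≥0∞) {c d : S → ℕ} (hc : Measurable c)
    (hcd : FiberRefines c d) (A : Set S) : ∑' n, N (c ⁻¹' {n} ∩ A) ≤ upperSum N d A :=
  le_iSup (fun c : {c : S → ℕ // Measurable c ∧ FiberRefines c d} =>
    ∑' n, N (c.1 ⁻¹' {n} ∩ A)) ⟨c, hc, hcd⟩

theorem upperLimit_le_upperSum (N : Set S → ℝ≥0∞) {d : S → ℕ} (hd : Measurable d)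
    (A : Set S) : upperLimit N A ≤ upperSum N d A :=
  iInf_le (fun d : {d : S → ℕ // Measurable d} => upperSum N d.1 A) ⟨d, hd⟩

theorem upperSum_le_of_determines {N : Set S → ℝ≥0∞} (hN0 : N ∅ = 0) {d e : S → ℕ}
    (he : Measurable e) {A : Set S} (hde : ∀ s ∈ A, ∀ t ∈ A, d s = d t → e s = e t) :
    upperSum N d A ≤ upperSum N e A := by
  refine iSup_le fun ⟨c, hc, hcd⟩ => ?_
  refine (tsum_fiber_le hN0 (d := e) fun s hs t ht hst => hde s hs t ht (hcd s t hst)).trans ?_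
  rw [← tsum_preimage_pair N e fun _ => c]
  refine le_upperSum N (measurable_pair he fun _ => hc) (fun s t hst => ?_) A
  exact (Nat.pair_eq_pair.1 hst).1

theorem upperSum_le_tsum {N : Set S → ℝ≥0∞} (hN0 : N ∅ = 0) {d i : S → ℕ}
    (hdi : FiberRefines d i) (A : Set S) :
    upperSum N d A ≤ ∑' k, upperSum N d (A ∩ i ⁻¹' {k}) := by
  refine iSup_le fun ⟨c, hc, hcd⟩ => ?_
  refine (tsum_fiber_le hN0 (d := i) fun s _ t _ hst => hdi s t (hcd s t hst)).trans ?_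
  exact ENNReal.tsum_le_tsum fun k => le_upperSum N hc hcd _

theorem tsum_upperSum_le {N : Set S → ℝ≥0∞} {d i : S → ℕ} (hi : Measurable i)
    (hd : Measurable d) (hfin : ∀ B, MeasurableSet B → upperSum N d B ≠ ∞) {A : Set S}
    (hA : MeasurableSet A) :
    ∑' k, upperSum N d (A ∩ i ⁻¹' {k}) ≤ upperSum N d A := by
  refine ENNReal.le_of_forall_pos_le_add fun ε hε _ => ?_
  obtain ⟨δ, hδ, hδε⟩ := ENNReal.exists_pos_sum_of_countable
    (ENNReal.coe_ne_zero.2 hε.ne') ℕ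
  have key : ∀ k, ∃ c : S → ℕ, (Measurable c ∧ FiberRefines c d) ∧
      upperSum N d (A ∩ i ⁻¹' {k}) ≤ ∑' n, N (c ⁻¹' {n} ∩ (A ∩ i ⁻¹' {k})) + δ k := by
    intro k
    by_cases h0 : upperSum N d (A ∩ i ⁻¹' {k}) = 0
    · exact ⟨d, ⟨hd, fun _ _ h => h⟩, by simp [h0]⟩
    · have hlt := ENNReal.sub_lt_self (hfin _ (hA.inter (hi (measurableSet_singleton k)))) h0
        (ENNReal.coe_ne_zero.2 (hδ k).ne')
      obtain ⟨⟨c, hc⟩, h⟩ := lt_iSup_iff.1 hlt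
      exact ⟨c, hc, tsub_le_iff_right.1 h.le⟩
  choose c hc hcle using key
  calc ∑' k, upperSum N d (A ∩ i ⁻¹' {k})
      ≤ ∑' k, (∑' n, N (c k ⁻¹' {n} ∩ (A ∩ i ⁻¹' {k})) + δ k) := ENNReal.tsum_le_tsum hcle
    _ = ∑' k, ∑' n, N (c k ⁻¹' {n} ∩ (A ∩ i ⁻¹' {k})) + ∑' k, (δ k : ℝ≥0∞) :=
        ENNReal.tsum_add
    _ ≤ upperSum N d A + ε := by
        refine add_le_add ?_ hδε.le
        rw [← tsum_preimage_pair]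
        refine le_upperSum N (measurable_pair hi fun k => (hc k).1) (fun s t hst => ?_) A
        obtain ⟨h1, h2⟩ := Nat.pair_eq_pair.1 hst
        rw [← h1] at h2
        exact (hc _).2 s t h2

theorem upperLimit_eq_tsum {N : Set S → ℝ≥0∞} (hN0 : N ∅ = 0)
    (hfin : ∀ d B, MeasurableSet B → upperSum N d B ≠ ∞) {i : S → ℕ}
    (hi : Measurable i) {A : Set S} (hA : MeasurableSet A) : upperLimit N A = ∑' k, upperLimit N (A ∩ i ⁻¹' {k}) := by
  apply le_antisymm
  · refine ENNReal.le_of_forall_pos_le_add fun ε hε _ => ?_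
    obtain ⟨δ, hδ, hδε⟩ := ENNReal.exists_pos_sum_of_countable
      (ENNReal.coe_ne_zero.2 hε.ne') ℕ
    have hlim : ∀ B, MeasurableSet B → upperLimit N B ≠ ∞ := fun B hB =>
      ne_top_of_le_ne_top (hfin _ B hB) (upperLimit_le_upperSum N hi B)
    have key : ∀ k, ∃ d : S → ℕ, Measurable d ∧
        upperSum N d (A ∩ i ⁻¹' {k}) ≤ upperLimit N (A ∩ i ⁻¹' {k}) + δ k := by
      intro k
      have hlt := ENNReal.lt_add_right (hlim _ (hA.inter (hi (measurableSet_singleton k))))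
        (ENNReal.coe_ne_zero.2 (hδ k).ne')
      obtain ⟨⟨d, hd⟩, h⟩ := iInf_lt_iff.1 hlt
      exact ⟨d, hd, h.le⟩
    choose d hd hdle using key
    have hm := measurable_pair hi hd
    calc upperLimit N A ≤ upperSum N (fun s => Nat.pair (i s) (d (i s) s)) A :=
          upperLimit_le_upperSum N hm A
      _ ≤ ∑' k, upperSum N (fun s => Nat.pair (i s) (d (i s) s)) (A ∩ i ⁻¹' {k}) :=
          upperSum_le_tsum hN0 (fun s t hst => (Nat.pair_eq_pair.1 hst).1) A
      _ ≤ ∑' k, (upperLimit N (A ∩ i ⁻¹' {k}) + δ k) := by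
          refine ENNReal.tsum_le_tsum fun k => le_trans ?_ (hdle k)
          refine upperSum_le_of_determines hN0 (hd k) ?_
          rintro s ⟨_, rfl⟩ t ⟨_, ht⟩ hst
          have h2 := (Nat.pair_eq_pair.1 hst).2
          rwa [show i t = i s from ht] at h2
      _ = ∑' k, upperLimit N (A ∩ i ⁻¹' {k}) + ∑' k, (δ k : ℝ≥0∞) := ENNReal.tsum_add
      _ ≤ _ := add_le_add le_rfl hδε.le
  · refine le_iInf fun ⟨d, hd⟩ => le_trans (ENNReal.tsum_le_tsum fun k => ?_)
      (tsum_upperSum_le hi hd (hfin d) hA)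
    exact upperLimit_le_upperSum N hd _

theorem upperLimit_eq_zero {N : Set S → ℝ≥0∞} {A : Set S}
    (h : ∀ c : S → ℕ, Measurable c → ∀ n, N (c ⁻¹' {n} ∩ A) = 0) : upperLimit N A = 0 := by
  refine le_antisymm ((upperLimit_le_upperSum N (measurable_const (a := 0)) A).trans ?_) bot_le
  exact iSup_le fun ⟨c, hc, _⟩ => by simp [h c hc]

/-- `upperLimit N` as a measure. -/
noncomputable def upperLimitMeasure (N : Set S → ℝ≥0∞) (hN0 : N ∅ = 0)
    (hfin : ∀ d B, MeasurableSet B → upperSum N d B ≠ ∞) : Measure S :=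
  Measure.ofMeasurable (fun A _ => upperLimit N A)
    (upperLimit_eq_zero fun c _ n => by simpa using hN0)
    (by
      intro f hf hd
      obtain ⟨i, hi, hif⟩ := exists_measurable_index hf hd
      rw [upperLimit_eq_tsum hN0 hfin hi (MeasurableSet.iUnion hf)]
      refine tsum_congr fun k => ?_
      congr 1
      ext s
      simp only [Set.mem_inter_iff, Set.mem_iUnion, Set.mem_preimage, Set.mem_singleton_iff]
      constructor
      · rintro ⟨⟨j, hj⟩, h⟩
        rwa [← h, hif j s hj]
      · exact fun h => ⟨⟨k, h⟩, hif k s h⟩)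

theorem upperLimitMeasure_apply {N : Set S → ℝ≥0∞} (hN0 : N ∅ = 0)
    (hfin : ∀ d B, MeasurableSet B → upperSum N d B ≠ ∞) {A : Set S} (hA : MeasurableSet A) :
    upperLimitMeasure N hN0 hfin A = upperLimit N A :=
  Measure.ofMeasurable_apply A hA

theorem isFiniteMeasure_upperLimitMeasure {N : Set S → ℝ≥0∞} (hN0 : N ∅ = 0)
    (hfin : ∀ d B, MeasurableSet B → upperSum N d B ≠ ∞) :
    IsFiniteMeasure (upperLimitMeasure N hN0 hfin) := by
  refine ⟨?_⟩
  rw [upperLimitMeasure_apply hN0 hfin MeasurableSet.univ]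
  exact (upperLimit_le_upperSum N (measurable_const (a := 0)) _).trans_lt
    (hfin _ _ MeasurableSet.univ).lt_top

/-- Some refinement of `d` has fibres on which `N` is close, in total, to its upper limit. -/
theorem exists_refinement_tsum_max_le {N : Set S → ℝ≥0∞} (hN0 : N ∅ = 0)
    (hfin : ∀ d B, MeasurableSet B → upperSum N d B ≠ ∞) {d : S → ℕ} (hd : Measurable d) {ε : ℝ≥0∞}
    (hε : ε ≠ 0) :
    ∃ c : S → ℕ, Measurable c ∧ FiberRefines c d ∧
      ∑' n, max (N (c ⁻¹' {n})) (upperLimit N (c ⁻¹' {n})) ≤ upperLimit N Set.univ + ε ∧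
      upperLimit N Set.univ ≤ ∑' n, N (c ⁻¹' {n}) + ε := by
  have hlim : upperLimit N Set.univ ≠ ∞ :=
    ne_top_of_le_ne_top (hfin d _ MeasurableSet.univ) (upperLimit_le_upperSum N hd _)
  obtain ⟨⟨e, he⟩, hle⟩ := iInf_lt_iff.1 (ENNReal.lt_add_right hlim hε)
  have hm : Measurable fun s => Nat.pair (d s) (e s) := measurable_pair hd (c := fun _ => e)
    fun _ => he
  have hle' : upperSum N (fun s => Nat.pair (d s) (e s)) Set.univ ≤
      upperLimit N Set.univ + ε := by
    refine (upperSum_le_of_determines hN0 he fun s _ t _ hst => ?_).trans hle.le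
    exact (Nat.pair_eq_pair.1 hst).2
  obtain ⟨c, ⟨hc, hcr⟩, hcle⟩ : ∃ c : S → ℕ, (Measurable c ∧
      FiberRefines c fun s => Nat.pair (d s) (e s)) ∧
      upperLimit N Set.univ ≤ ∑' n, N (c ⁻¹' {n} ∩ Set.univ) + ε := by
    by_cases h0 : upperLimit N Set.univ = 0
    · exact ⟨_, ⟨hm, fun _ _ h => h⟩, by simp [h0]⟩
    · have hlt := (ENNReal.sub_lt_self hlim h0 hε).trans_le (upperLimit_le_upperSum N hm _)
      obtain ⟨⟨c, hc⟩, h⟩ := lt_iSup_iff.1 hlt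
      exact ⟨c, hc, tsub_le_iff_right.1 h.le⟩
  refine ⟨c, hc, fun s t hst => (Nat.pair_eq_pair.1 (hcr s t hst)).1, ?_, by simpa using hcle⟩
  refine le_trans (ENNReal.tsum_le_tsum fun n => ?_)
    ((tsum_upperSum_le hc hm (hfin _) MeasurableSet.univ).trans hle')
  rw [Set.univ_inter]
  refine max_le ?_ (upperLimit_le_upperSum N hm _)
  refine le_trans ?_ (le_upperSum N hc hcr _)
  refine le_trans (le_of_eq ?_) (ENNReal.le_tsum n)
  rw [Set.inter_self]

/-- A real form of `exists_refinement_tsum_max_le`: some refinement of `d` makes the weighted sums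
for `N` and for its upper limit close, uniformly in bounded weights. -/
theorem exists_refinement_tsum_mul_le {N : Set S → ℝ≥0∞} (hN0 : N ∅ = 0)
    (hfin : ∀ d B, MeasurableSet B → upperSum N d B ≠ ∞) {d : S → ℕ} (hd : Measurable d)
    {ε : ℝ} (hε : 0 < ε) :
    ∃ c : S → ℕ, Measurable c ∧ FiberRefines c d ∧ ∀ (M : ℝ) (g : ℕ → ℝ), (∀ n, |g n| ≤ M) →
      ∑' n, (upperLimitMeasure N hN0 hfin).real (c ⁻¹' {n}) * g n ≤
        ∑' n, (N (c ⁻¹' {n})).toReal * g n + 3 * M * ε := by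
  obtain ⟨c, hc, hcd, hmax, hlow⟩ := exists_refinement_tsum_max_le hN0 hfin hd
    (ε := ENNReal.ofReal ε) (by simpa using hε)
  refine ⟨c, hc, hcd, fun M g hg => ?_⟩
  have hfib : ∀ n, MeasurableSet (c ⁻¹' {n}) := fun n => hc (measurableSet_singleton n)
  have hL : upperLimit N Set.univ ≠ ∞ :=
    ne_top_of_le_ne_top (hfin d _ MeasurableSet.univ) (upperLimit_le_upperSum N hd _)
  have hmaxtop : ∑' n, max (N (c ⁻¹' {n})) (upperLimit N (c ⁻¹' {n})) ≠ ∞ :=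
    ne_top_of_le_ne_top (ENNReal.add_ne_top.2 ⟨hL, ENNReal.ofReal_ne_top⟩) hmax
  have hNtop : ∑' n, N (c ⁻¹' {n}) ≠ ∞ :=
    ne_top_of_le_ne_top hmaxtop (ENNReal.tsum_le_tsum fun n => le_max_left _ _)
  have hsum := upperLimit_eq_tsum hN0 hfin hc MeasurableSet.univ
  simp only [Set.univ_inter] at hsum
  have hLtop : ∑' n, upperLimit N (c ⁻¹' {n}) ≠ ∞ := hsum ▸ hL
  have hmax' := ENNReal.toReal_mono (ENNReal.add_ne_top.2 ⟨hL, ENNReal.ofReal_ne_top⟩) hmax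
  have hlow' := ENNReal.toReal_mono (ENNReal.add_ne_top.2 ⟨hNtop, ENNReal.ofReal_ne_top⟩) hlow
  rw [ENNReal.toReal_add hL ENNReal.ofReal_ne_top, ENNReal.toReal_ofReal hε.le,
    ENNReal.tsum_toReal_eq (ENNReal.ne_top_of_tsum_ne_top hmaxtop)] at hmax'
  rw [ENNReal.toReal_add hNtop ENNReal.ofReal_ne_top, ENNReal.toReal_ofReal hε.le,
    ENNReal.tsum_toReal_eq (ENNReal.ne_top_of_tsum_ne_top hNtop)] at hlow'
  have hsum' := congrArg ENNReal.toReal hsum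
  rw [ENNReal.tsum_toReal_eq (ENNReal.ne_top_of_tsum_ne_top hLtop)] at hsum'
  have hx := ENNReal.summable_toReal hNtop
  have hy := ENNReal.summable_toReal hLtop
  have hz := ENNReal.summable_toReal hmaxtop
  simp only [measureReal_def, upperLimitMeasure_apply hN0 hfin (hfib _)]
  have hM : 0 ≤ M := (abs_nonneg _).trans (hg 0)
  have hmul : ∀ {w : ℕ → ℝ}, (∀ n, 0 ≤ w n) → Summable w → Summable fun n => w n * g n := by
    intro w hw0 hw
    refine Summable.of_norm_bounded (hw.mul_right M) fun n => ?_
    rw [Real.norm_eq_abs, abs_mul, abs_of_nonneg (hw0 n)]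
    exact mul_le_mul_of_nonneg_left (hg n) (hw0 n)
  have hxg := hmul (fun n => ENNReal.toReal_nonneg) hx
  have hyg := hmul (fun n => ENNReal.toReal_nonneg) hy
  have hpt : ∀ n, (upperLimit N (c ⁻¹' {n})).toReal * g n - (N (c ⁻¹' {n})).toReal * g n ≤
      M * (2 * (max (N (c ⁻¹' {n})) (upperLimit N (c ⁻¹' {n}))).toReal -
        (N (c ⁻¹' {n})).toReal - (upperLimit N (c ⁻¹' {n})).toReal) := by
    intro n
    rw [ENNReal.toReal_max (ENNReal.ne_top_of_tsum_ne_top hNtop n)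
      (ENNReal.ne_top_of_tsum_ne_top hLtop n), ← sub_mul]
    obtain ⟨h1, h2⟩ := abs_le.1 (hg n)
    rcases le_total (N (c ⁻¹' {n})).toReal (upperLimit N (c ⁻¹' {n})).toReal with h | h
    · rw [max_eq_right h]
      nlinarith
    · rw [max_eq_left h]
      nlinarith
  have hle := (hyg.sub hxg).tsum_le_tsum hpt ((((hz.mul_left 2).sub hx).sub hy).mul_left M)
  rw [hyg.tsum_sub hxg, tsum_mul_left, ((hz.mul_left 2).sub hx).tsum_sub hy,
    (hz.mul_left 2).tsum_sub hx, tsum_mul_left] at hle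
  nlinarith

end UpperLimit

theorem exists_tags_le_add {S : Type*} [Nonempty S] {f : S → ℝ} {M : ℝ} (hf : ∀ s, |f s| ≤ M)
    (P : ℕ → Set S) {ε : ℝ} (hε : 0 < ε) :
    ∃ t : ℕ → S, AreTags P t ∧ ∀ n, ∀ s ∈ P n, f s ≤ f (t n) + ε := by
  have key : ∀ n, ∃ t : S, ((P n).Nonempty → t ∈ P n) ∧ ∀ s ∈ P n, f s ≤ f t + ε := by
    intro n
    rcases (P n).eq_empty_or_nonempty with h0 | hne
    · exact ⟨Classical.arbitrary S, by simp [h0], by simp [h0]⟩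
    · have hb : BddAbove (f '' P n) :=
        ⟨M, by rintro _ ⟨s, _, rfl⟩; exact (abs_le.1 (hf s)).2⟩
      obtain ⟨_, ⟨t, ht, rfl⟩, hlt⟩ :=
        exists_lt_of_lt_csSup (hne.image f) (sub_lt_self (sSup (f '' P n)) hε)
      refine ⟨t, fun _ => ht, fun s hs => ?_⟩
      linarith [le_csSup hb (Set.mem_image_of_mem f hs)]
  choose t ht hle using key
  exact ⟨t, ht, hle⟩

section Integral

variable {S : Type*} [MeasurableSpace S]

theorem tsum_ofReal_le_of_variation {ν : Set S → ℝ}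
    (hνnn : ∀ A : Set S, MeasurableSet A → 0 ≤ ν A) {V : ℝ}
    (hV : V ∈ upperBounds (variationSet ν Set.univ)) {c : S → ℕ} (hc : Measurable c)
    {B : Set S} (hB : MeasurableSet B) :
    ∑' n, ENNReal.ofReal (ν (c ⁻¹' {n} ∩ B)) ≤ ENNReal.ofReal V := by
  have hm : ∀ n, MeasurableSet (c ⁻¹' {n} ∩ B) := fun n =>
    (hc (measurableSet_singleton n)).inter hB
  rw [ENNReal.tsum_eq_iSup_nat]
  refine iSup_le fun k => ?_
  rw [← ENNReal.ofReal_sum_of_nonneg fun n _ => hνnn _ (hm n)]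
  refine ENNReal.ofReal_le_ofReal (hV ⟨k, fun i => c ⁻¹' {(i : ℕ)} ∩ B, fun i => hm i,
    fun i => Set.subset_univ _, fun i j hij => ?_, ?_⟩)
  · refine Set.disjoint_left.2 fun s hs hs' => hij (Fin.ext ?_)
    exact hs.1.symm.trans hs'.1
  · exact (Fin.sum_univ_eq_sum_range (fun n => ν (c ⁻¹' {n} ∩ B)) k).symm

theorem upperSum_ofReal_ne_top {ν : Set S → ℝ}
    (hνnn : ∀ A : Set S, MeasurableSet A → 0 ≤ ν A) (hfv : FiniteVariation ν) (d : S → ℕ)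
    (B : Set S) (hB : MeasurableSet B) : upperSum (fun A => ENNReal.ofReal (ν A)) d B ≠ ∞ := by
  obtain ⟨V, hV⟩ := hfv
  exact ne_top_of_le_ne_top ENNReal.ofReal_ne_top
    (iSup_le fun ⟨c, hc, _⟩ => tsum_ofReal_le_of_variation hνnn hV hc hB)

theorem isCtblePartition_fibers {c : S → ℕ} (hc : Measurable c) :
    IsCtblePartition Set.univ fun n => c ⁻¹' {n} := by
  refine ⟨fun n => hc (measurableSet_singleton n), fun i j hij => ?_, ?_⟩
  · exact Set.disjoint_left.2 fun s hs hs' => hij (hs.symm.trans hs')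
  · exact Set.eq_univ_of_forall fun s => Set.mem_iUnion.2 ⟨c s, rfl⟩

theorem AbsRL.neg {X : Type*} [NormedAddCommGroup X] [NormedSpace ℝ X] {ν : Set S → ℝ}
    {f : S → X} {E : Set S} {a : X} (hf : AbsRL ν f E a) : AbsRL ν (-f) E (-a) := by
  intro ε hε
  obtain ⟨P₀, hP₀, h⟩ := hf ε hε
  refine ⟨P₀, hP₀, fun P hP hPf => ?_⟩
  obtain ⟨hb, ht⟩ := h P hP hPf
  refine ⟨by simpa using hb, fun t hPt => ?_⟩
  obtain ⟨hs, hd⟩ := ht t hPt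
  refine ⟨by simpa using hs, ?_⟩
  simp only [Pi.neg_apply, smul_neg, tsum_neg]
  rwa [neg_sub_neg, norm_sub_rev]

theorem AbsRL.exists_index {X : Type*} [NormedAddCommGroup X] [NormedSpace ℝ X]
    {ν : Set S → ℝ} {f : S → X} {a : X} (hf : AbsRL ν f Set.univ a) {ε : ℝ} (hε : 0 < ε) :
    ∃ d : S → ℕ, Measurable d ∧ ∀ c : S → ℕ, Measurable c → FiberRefines c d →
      ∀ t : ℕ → S, AreTags (fun n => c ⁻¹' {n}) t →
        ‖(∑' n, ν (c ⁻¹' {n}) • f (t n)) - a‖ < ε := by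
  obtain ⟨P₀, ⟨hm, hd, hU⟩, h⟩ := hf ε hε
  obtain ⟨d, hdm, hdP⟩ := exists_measurable_index hm hd
  refine ⟨d, hdm, fun c hc hcd t ht => ?_⟩
  refine ((h _ (isCtblePartition_fibers hc) fun n => ?_).2 t ht).2
  rcases (c ⁻¹' {n}).eq_empty_or_nonempty with h0 | ⟨s, hs⟩
  · exact ⟨0, by simp [h0]⟩
  · refine ⟨d s, fun s' hs' => ?_⟩
    obtain ⟨k, hk⟩ := Set.mem_iUnion.1 (hU.symm ▸ Set.mem_univ s' : s' ∈ ⋃ n, P₀ n)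
    rw [hcd s s' (hs.trans hs'.symm), hdP k s' hk]
    exact hk

theorem integral_comp_nat {μ : Measure S} [IsFiniteMeasure μ] {c : S → ℕ} (hc : Measurable c)
    {g : ℕ → ℝ} {M : ℝ} (hg : ∀ n, |g n| ≤ M) :
    ∫ s, g (c s) ∂μ = ∑' n, μ.real (c ⁻¹' {n}) * g n := by
  have hgm : AEStronglyMeasurable g (μ.map c) :=
    (measurable_from_nat (f := g)).aestronglyMeasurable
  rw [← integral_map hc.aemeasurable hgm, integral_countable]
  · refine tsum_congr fun n => ?_
    rw [map_measureReal_apply hc (measurableSet_singleton n), smul_eq_mul]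
  · exact Integrable.of_bound hgm M (ae_of_all _ hg)

/-- A bounded `|RL|`-integrable function has measurable majorants whose integrals for the upper
limit measure approximate the `|RL|`-integral. -/
theorem AbsRL.exists_measurable_majorant [Nonempty S] {ν : Set S → ℝ}
    (hνnn : ∀ A : Set S, MeasurableSet A → 0 ≤ ν A) {N : Set S → ℝ≥0∞}
    (hNν : ∀ A, N A = ENNReal.ofReal (ν A)) (hN0 : N ∅ = 0)
    (hfin : ∀ d B, MeasurableSet B → upperSum N d B ≠ ∞) {f : S → ℝ} {M : ℝ}
    (hfM : ∀ s, |f s| ≤ M) {a : ℝ} (hf : AbsRL ν f Set.univ a) {ε : ℝ} (hε : 0 < ε) :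
    ∃ U : S → ℝ, Measurable U ∧ (∀ s, f s ≤ U s) ∧ (∀ s, U s ≤ M + ε) ∧
      ∫ s, U s ∂(upperLimitMeasure N hN0 hfin) ≤
        a + (1 + 3 * M + (upperLimitMeasure N hN0 hfin).real Set.univ) * ε := by
  have := isFiniteMeasure_upperLimitMeasure hN0 hfin
  obtain ⟨d, hd, hsum⟩ := hf.exists_index hε
  obtain ⟨c, hc, hcd, hclose⟩ := exists_refinement_tsum_mul_le hN0 hfin hd hε
  obtain ⟨t, ht, htle⟩ := exists_tags_le_add hfM (fun n => c ⁻¹' {n}) hε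
  have hfc : Measurable fun s => f (t (c s)) :=
    (measurable_from_nat (f := fun n => f (t n))).comp hc
  refine ⟨fun s => f (t (c s)) + ε, hfc.add_const ε, fun s => htle (c s) s rfl,
    fun s => add_le_add (abs_le.1 (hfM _)).2 le_rfl, ?_⟩
  have h1 := hclose M (fun n => f (t n)) fun n => hfM _
  have h2 := (abs_lt.1 (hsum c hc hcd t ht)).2
  have hN : ∀ n, (N (c ⁻¹' {n})).toReal = ν (c ⁻¹' {n}) := fun n => by
    rw [hNν, ENNReal.toReal_ofReal (hνnn _ (hc (measurableSet_singleton n)))]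
  simp only [hN] at h1
  simp only [smul_eq_mul] at h2
  rw [integral_add (Integrable.of_bound hfc.aestronglyMeasurable M (ae_of_all _ fun s => hfM _))
    (integrable_const _), integral_comp_nat hc (g := fun n => f (t n)) (fun n => hfM _),
    integral_const, smul_eq_mul]
  linarith

theorem exists_measurable_majorant_integral_le {μ : Measure S} [IsFiniteMeasure μ] {f : S → ℝ}
    {M : ℝ} (hfM : ∀ s, |f s| ≤ M) {a C : ℝ}
    (h : ∀ ε > 0, ∃ U : S → ℝ, Measurable U ∧ (∀ s, f s ≤ U s) ∧ (∀ s, U s ≤ M + ε) ∧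
      ∫ s, U s ∂μ ≤ a + C * ε) :
    ∃ U : S → ℝ, Measurable U ∧ (∀ s, f s ≤ U s) ∧ Integrable U μ ∧ ∫ s, U s ∂μ ≤ a := by
  choose U hUm hfU hUM hUa using fun j : ℕ => h (1 / ((j : ℝ) + 1)) Nat.one_div_pos_of_nat
  have hbdd : ∀ s, BddBelow (Set.range fun j => U j s) := fun s =>
    ⟨f s, by rintro _ ⟨j, rfl⟩; exact hfU j s⟩
  have hle : ∀ j s, ⨅ j, U j s ≤ U j s := fun j s => ciInf_le (hbdd s) j
  have hge : ∀ s, f s ≤ ⨅ j, U j s := fun s => le_ciInf fun j => hfU j s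
  have hm : Measurable fun s => ⨅ j, U j s := Measurable.iInf hUm
  have hb : ∀ g : S → ℝ, Measurable g → (∀ s, f s ≤ g s) → ∀ K, (∀ s, g s ≤ M + K) →
      Integrable g μ := fun g hg hfg K hgK =>
    Integrable.of_bound hg.aestronglyMeasurable (M + |K|) (ae_of_all _ fun s => by
      rw [Real.norm_eq_abs, abs_le]
      constructor
      · linarith [(abs_le.1 (hfM s)).1, hfg s, abs_nonneg K]
      · linarith [hgK s, le_abs_self K])
  have hint := hb _ hm hge _ fun s => (hle 0 s).trans (hUM 0 s)
  refine ⟨_, hm, hge, hint, ?_⟩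
  have hlim : Tendsto (fun j : ℕ => a + C * (1 / ((j : ℝ) + 1))) atTop (𝓝 (a + C * 0)) :=
    (tendsto_one_div_add_atTop_nhds_zero_nat.const_mul C).const_add a
  rw [mul_zero, add_zero] at hlim
  refine ge_of_tendsto' hlim fun j => le_trans ?_ (hUa j)
  exact integral_mono hint (hb _ (hUm j) (hfU j) _ (hUM j)) (hle j)

/-- A bounded `|RL|`-integrable function is a.e. measurable for the upper limit measure, and its
`|RL|`-integral is the Bochner integral for that measure. -/
theorem AbsRL.aemeasurable_and_integral_eq [Nonempty S] {ν : Set S → ℝ}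
    (hνnn : ∀ A : Set S, MeasurableSet A → 0 ≤ ν A) {N : Set S → ℝ≥0∞}
    (hNν : ∀ A, N A = ENNReal.ofReal (ν A)) (hN0 : N ∅ = 0)
    (hfin : ∀ d B, MeasurableSet B → upperSum N d B ≠ ∞) {f : S → ℝ} {M : ℝ}
    (hfM : ∀ s, |f s| ≤ M) {a : ℝ} (hf : AbsRL ν f Set.univ a) :
    AEMeasurable f (upperLimitMeasure N hN0 hfin) ∧
      ∫ s, f s ∂(upperLimitMeasure N hN0 hfin) = a := by
  have := isFiniteMeasure_upperLimitMeasure hN0 hfin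
  obtain ⟨U, hUm, hfU, hUi, hUa⟩ := exists_measurable_majorant_integral_le hfM
    fun ε hε => hf.exists_measurable_majorant hνnn hNν hN0 hfin hfM hε
  have hfM' : ∀ s, |(-f) s| ≤ M := fun s => by simpa using hfM s
  obtain ⟨W, hWm, hfW, hWi, hWa⟩ := exists_measurable_majorant_integral_le hfM'
    fun ε hε => hf.neg.exists_measurable_majorant hνnn hNν hN0 hfin hfM' hε
  have hnn : 0 ≤ U + W := fun s => by
    have h1 := hfU s
    have h2 := hfW s
    simp only [Pi.neg_apply, Pi.zero_apply, Pi.add_apply] at *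
    linarith
  have hadd := integral_add hUi hWi
  have hpos := integral_nonneg (μ := upperLimitMeasure N hN0 hfin) hnn
  simp only [Pi.add_apply] at hpos
  have hzero := (integral_eq_zero_iff_of_nonneg hnn (hUi.add hWi)).1
    (by simp only [Pi.add_apply]; linarith)
  have hae : f =ᵐ[upperLimitMeasure N hN0 hfin] U := by
    filter_upwards [hzero] with s hs
    have h1 := hfU s
    have h2 := hfW s
    simp only [Pi.neg_apply, Pi.zero_apply, Pi.add_apply] at *
    linarith
  refine ⟨⟨U, hUm, hae⟩, ?_⟩
  rw [integral_congr_ae hae]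
  linarith

end Integral

/-- convergence of the `|RL|` integrals for a uniformly bounded sequence
converging `ν`-almost everywhere, when `ν` is monotone, of finite variation and `ν̃`
satisfies condition (E). -/
theorem absRL_tendsto_of_ae_convergence
    {S : Type*} [Nonempty S] [MeasurableSpace S]
    (ν : Set S → ℝ) (hν0 : ν ∅ = 0) (hνnn : ∀ A : Set S, MeasurableSet A → 0 ≤ ν A)
    (hmono : ∀ A B : Set S, MeasurableSet A → MeasurableSet B → A ⊆ B → ν A ≤ ν B)
    (hfv : FiniteVariation ν)
    (hE : ConditionE (semivariation ν))
    (h : S → ℝ) (hn : ℕ → S → ℝ)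
    (hb : ∃ M : ℝ, (∀ s : S, |h s| ≤ M) ∧ ∀ (n : ℕ) (s : S), |hn n s| ≤ M)
    (a : ℝ) (an : ℕ → ℝ)
    (hh : AbsRL ν h Set.univ a) (hhn : ∀ n : ℕ, AbsRL ν (hn n) Set.univ (an n))
    (hae : ∃ E : Set S, MeasurableSet E ∧ ν E = 0 ∧
      ∀ s ∉ E, Filter.Tendsto (fun n => hn n s) Filter.atTop (nhds (h s))) :
    Filter.Tendsto an Filter.atTop (nhds a) := by
  obtain ⟨M, hM, hMn⟩ := hb
  obtain ⟨E, hEm, hE0, hlim⟩ := hae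
  have hN0 : (fun A => ENNReal.ofReal (ν A)) ∅ = 0 := by simp [hν0]
  have hfin := upperSum_ofReal_ne_top hνnn hfv
  have hfinite := isFiniteMeasure_upperLimitMeasure hN0 hfin
  obtain ⟨-, ha⟩ := hh.aemeasurable_and_integral_eq hνnn (fun _ => rfl) hN0 hfin hM
  have han := fun n =>
    (hhn n).aemeasurable_and_integral_eq hνnn (fun _ => rfl) hN0 hfin (hMn n)
  have hnull : upperLimitMeasure _ hN0 hfin E = 0 := by
    rw [upperLimitMeasure_apply hN0 hfin hEm]
    refine upperLimit_eq_zero fun c hc n => ENNReal.ofReal_eq_zero.2 (hE0 ▸ ?_)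
    exact hmono _ _ ((hc (measurableSet_singleton n)).inter hEm) hEm Set.inter_subset_right
  rw [← ha, ← funext fun n => (han n).2]
  refine tendsto_integral_of_dominated_convergence (fun _ => M)
    (fun n => (han n).1.aestronglyMeasurable) (integrable_const M)
    (fun n => ae_of_all _ (hMn n)) ?_
  filter_upwards [measure_eq_zero_iff_ae_notMem.1 hnull] with s hs using hlim s hs
end

section
/- Let ν be monotone and of finite variation, and suppose the semivariation ν̃ satisfies condition (E). For each n ∈ ℕ let h_n : S → ℝ, and suppose the sequence (h_n) is uniformly bounded, i.e. sup{ |h_n(s)| : s ∈ S, n ∈ ℕ } < ∞. Then (|RL|)∫_S (liminf_n h_n) dν ≤ liminf_n ( (|RL|)∫_S h_n dν ). -/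
open Filter Topology

theorem exists_areTags {S : Type*} [Nonempty S] (P : ℕ → Set S) : ∃ t, AreTags P t := by
  classical
  refine ⟨fun n => if h : (P n).Nonempty then h.some else Classical.arbitrary S, fun n h => ?_⟩
  simpa [h] using h.some_mem

section Variation

variable {S : Type*} [MeasurableSpace S] {ν : Set S → ℝ}

theorem FiniteVariation.bddAbove (hfv : FiniteVariation ν) (E : Set S) :
    BddAbove (variationSet ν E) := by
  refine hfv.mono ?_
  rintro x ⟨k, A, hA, -, hd, rfl⟩
  exact ⟨k, A, hA, fun i => Set.subset_univ _, hd, rfl⟩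

theorem zero_mem_variationSet (ν : Set S → ℝ) (E : Set S) : (0 : ℝ) ∈ variationSet ν E :=
  ⟨0, fun _ => ∅, fun i => i.elim0, fun i => i.elim0, fun i => i.elim0, by simp⟩

theorem FiniteVariation.variation_nonneg (hfv : FiniteVariation ν) (E : Set S) :
    0 ≤ variation ν E :=
  le_csSup (hfv.bddAbove E) (zero_mem_variationSet ν E)

theorem FiniteVariation.variation_mono (hfv : FiniteVariation ν) {E F : Set S} (h : E ⊆ F) :
    variation ν E ≤ variation ν F := by
  refine csSup_le_csSup (hfv.bddAbove F) ⟨0, zero_mem_variationSet ν E⟩ ?_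
  rintro x ⟨k, A, hA, hAE, hd, rfl⟩
  exact ⟨k, A, hA, fun i => (hAE i).trans h, hd, rfl⟩

theorem variation_empty (hν0 : ν ∅ = 0) : variation ν ∅ = 0 := by
  have h : variationSet ν ∅ = {0} := by
    refine Set.Subset.antisymm ?_ (by simpa using zero_mem_variationSet ν ∅)
    rintro x ⟨k, A, -, hAE, -, rfl⟩
    simp [fun i => Set.subset_empty_iff.1 (hAE i), hν0]
  rw [variation, h, csSup_singleton]

theorem FiniteVariation.variation_le_semivariation (hfv : FiniteVariation ν) {E F : Set S}
    (h : E ⊆ F) : variation ν E ≤ semivariation ν F := by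
  refine le_csInf ⟨_, Set.univ, MeasurableSet.univ, Set.subset_univ _, rfl⟩ ?_
  rintro x ⟨B, -, hFB, rfl⟩
  exact hfv.variation_mono (h.trans hFB)

theorem FiniteVariation.semivariation_empty (hfv : FiniteVariation ν) (hν0 : ν ∅ = 0) :
    semivariation ν ∅ = 0 := by
  refine le_antisymm (csInf_le ⟨0, ?_⟩ ⟨∅, MeasurableSet.empty, subset_rfl, ?_⟩) ?_
  · rintro x ⟨B, -, -, rfl⟩
    exact hfv.variation_nonneg B
  · exact (variation_empty hν0).symm
  · exact (hfv.variation_nonneg ∅).trans (hfv.variation_le_semivariation subset_rfl)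

theorem FiniteVariation.sum_range_le_variation (hfv : FiniteVariation ν) {E : Set S}
    {A : ℕ → Set S} (hA : ∀ i, MeasurableSet (A i)) (hAE : ∀ i, A i ⊆ E)
    (hd : Pairwise (Function.onFun Disjoint A)) (n : ℕ) :
    ∑ i ∈ Finset.range n, ν (A i) ≤ variation ν E := by
  rw [← Fin.sum_univ_eq_sum_range (fun i => ν (A i))]
  exact le_csSup (hfv.bddAbove E) ⟨n, fun i => A i, fun i => hA i, fun i => hAE i,
    fun i j hij => hd (fun h => hij (Fin.ext h)), rfl⟩

theorem FiniteVariation.summable (hfv : FiniteVariation ν)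
    (hνnn : ∀ A : Set S, MeasurableSet A → 0 ≤ ν A)
    {A : ℕ → Set S} (hA : ∀ i, MeasurableSet (A i))
    (hd : Pairwise (Function.onFun Disjoint A)) : Summable fun i => ν (A i) :=
  summable_of_sum_range_le (fun i => hνnn _ (hA i))
    (hfv.sum_range_le_variation hA (fun _ => Set.subset_univ _) hd)

theorem FiniteVariation.tsum_le_variation (hfv : FiniteVariation ν)
    (hνnn : ∀ A : Set S, MeasurableSet A → 0 ≤ ν A) {E : Set S}
    {A : ℕ → Set S} (hA : ∀ i, MeasurableSet (A i)) (hAE : ∀ i, A i ⊆ E)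
    (hd : Pairwise (Function.onFun Disjoint A)) : ∑' i, ν (A i) ≤ variation ν E :=
  Real.tsum_le_of_sum_range_le (fun i => hνnn _ (hA i))
    (hfv.sum_range_le_variation hA hAE hd)

/-- Any two countable partitions have a common refinement. -/
theorem IsCtblePartition.exists_finerThan {E : Set S} {P Q : ℕ → Set S}
    (hP : IsCtblePartition E P) (hQ : IsCtblePartition E Q) :
    ∃ R, IsCtblePartition E R ∧ FinerThan P R ∧ FinerThan Q R := by
  refine ⟨fun n => P n.unpair.1 ∩ Q n.unpair.2, ⟨fun n => (hP.1 _).inter (hQ.1 _), ?_, ?_⟩,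
    fun n => ⟨_, Set.inter_subset_left⟩, fun n => ⟨_, Set.inter_subset_right⟩⟩
  · intro i j hij
    by_cases h1 : i.unpair.1 = j.unpair.1
    · have h2 : i.unpair.2 ≠ j.unpair.2 := fun h2 => hij <| by
        rw [← Nat.pair_unpair i, ← Nat.pair_unpair j, h1, h2]
      exact (hQ.2.1 h2).mono Set.inter_subset_right Set.inter_subset_right
    · exact (hP.2.1 h1).mono Set.inter_subset_left Set.inter_subset_left
  · rw [Set.iUnion_unpair (fun i j => P i ∩ Q j)]
    simp_rw [← Set.inter_iUnion, hQ.2.2, ← Set.iUnion_inter, hP.2.2, Set.inter_self]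

/-- The integral of a function bounded by `M` is at most `M` times the variation. -/
theorem AbsRL.le_mul_variation [Nonempty S] (hfv : FiniteVariation ν)
    (hνnn : ∀ A : Set S, MeasurableSet A → 0 ≤ ν A) {h : S → ℝ} {a M : ℝ} (hM0 : 0 ≤ M)
    (hM : ∀ s, |h s| ≤ M) (ha : AbsRL ν h Set.univ a) : a ≤ M * variation ν Set.univ := by
  refine le_of_forall_pos_le_add fun ε hε => ?_
  obtain ⟨P, hP, H⟩ := ha ε hε
  obtain ⟨t, ht⟩ := exists_areTags P
  obtain ⟨hs, hlt⟩ := (H P hP fun n => ⟨n, subset_rfl⟩).2 t ht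
  have hle : ∑' n, ν (P n) • h (t n) ≤ ∑' n, M * ν (P n) := by
    refine hs.of_norm.tsum_le_tsum (fun n => ?_) ((hfv.summable hνnn hP.1 hP.2.1).mul_left M)
    rw [smul_eq_mul, mul_comm]
    exact mul_le_mul_of_nonneg_right ((le_abs_self _).trans (hM _)) (hνnn _ (hP.1 n))
  rw [tsum_mul_left] at hle
  have hV := mul_le_mul_of_nonneg_left
    (hfv.tsum_le_variation hνnn hP.1 (fun _ => Set.subset_univ _) hP.2.1) hM0
  rw [Real.norm_eq_abs, abs_lt] at hlt
  linarith

/-- If the integral of `f` exceeds that of `h` by `δ`, then `f` exceeds `h` uniformly on a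
measurable set whose variation is bounded below in terms of `δ`. -/
theorem AbsRL.exists_measurableSet_le_sub [Nonempty S] (hν0 : ν ∅ = 0)
    (hfv : FiniteVariation ν) (hνnn : ∀ A : Set S, MeasurableSet A → 0 ≤ ν A)
    {f h : S → ℝ} {a b M δ η : ℝ} (hM0 : 0 < M) (hfM : ∀ s, |f s| ≤ M) (hhM : ∀ s, |h s| ≤ M)
    (hf : AbsRL ν f Set.univ b) (hh : AbsRL ν h Set.univ a) (hδ : 0 < δ) (hab : a + δ ≤ b)
    (hη : 0 ≤ η) (hηδ : η * variation ν Set.univ ≤ δ / 4) :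
    ∃ G, MeasurableSet G ∧ (∀ s ∈ G, η ≤ f s - h s) ∧ δ / (8 * M) ≤ variation ν G := by
  classical
  obtain ⟨P, hP, HP⟩ := hf (δ / 4) (by positivity)
  obtain ⟨Q, hQ, HQ⟩ := hh (δ / 4) (by positivity)
  obtain ⟨R, hR, hPR, hQR⟩ := hP.exists_finerThan hQ
  have htag : ∀ i, ∃ s, ((R i).Nonempty → s ∈ R i) ∧
      ((∀ x ∈ R i, η ≤ f x - h x) ∨ f s - h s < η) := by
    intro i
    by_cases hg : ∀ x ∈ R i, η ≤ f x - h x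
    · obtain ⟨t, ht⟩ := exists_areTags R
      exact ⟨t i, ht i, Or.inl hg⟩
    · push Not at hg
      obtain ⟨x, hx, hlt⟩ := hg
      exact ⟨x, fun _ => hx, Or.inr hlt⟩
  choose t ht htg using htag
  set A : ℕ → Set S := fun i => if ∀ x ∈ R i, η ≤ f x - h x then R i else ∅ with hAdef
  have hAR : ∀ i, A i ⊆ R i := fun i => by
    simp only [hAdef]; split_ifs <;> simp
  have hA : ∀ i, MeasurableSet (A i) := fun i => by
    simp only [hAdef]; split_ifs
    exacts [hR.1 i, MeasurableSet.empty]
  have hAd : Pairwise (Function.onFun Disjoint A) :=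
    fun i j hij => (hR.2.1 hij).mono (hAR i) (hAR j)
  refine ⟨⋃ i, A i, MeasurableSet.iUnion hA, ?_, ?_⟩
  · intro s hs
    obtain ⟨i, hi⟩ := Set.mem_iUnion.1 hs
    simp only [hAdef] at hi
    split_ifs at hi with hg
    exacts [hg s hi, hi.elim]
  · obtain ⟨hfs, hflt⟩ := (HP R hR hPR).2 t ht
    obtain ⟨hhs, hhlt⟩ := (HQ R hR hQR).2 t ht
    have hsR := hfv.summable hνnn hR.1 hR.2.1
    have hsA := hfv.summable hνnn hA hAd
    have hle : ∑' i, (ν (R i) • f (t i) - ν (R i) • h (t i)) ≤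
        ∑' i, (η * ν (R i) + 2 * M * ν (A i)) := by
      refine (hfs.of_norm.sub hhs.of_norm).tsum_le_tsum (fun i => ?_)
        ((hsR.mul_left η).add (hsA.mul_left (2 * M)))
      have hνi := hνnn _ (hR.1 i)
      have hu : f (t i) - h (t i) ≤ 2 * M := by
        linarith [(abs_le.1 (hfM (t i))).2, (abs_le.1 (hhM (t i))).1]
      rw [smul_eq_mul, smul_eq_mul, ← mul_sub]
      by_cases hg : ∀ x ∈ R i, η ≤ f x - h x
      · have hAi : A i = R i := if_pos hg
        rw [hAi]
        nlinarith [mul_le_mul_of_nonneg_left hu hνi, mul_nonneg hη hνi]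
      · have hAi : A i = ∅ := if_neg hg
        rw [hAi, hν0]
        nlinarith [mul_le_mul_of_nonneg_left ((htg i).resolve_left hg).le hνi]
    rw [hfs.of_norm.tsum_sub hhs.of_norm, (hsR.mul_left η).tsum_add (hsA.mul_left (2 * M)),
      tsum_mul_left, tsum_mul_left] at hle
    have hVR := mul_le_mul_of_nonneg_left
      (hfv.tsum_le_variation hνnn hR.1 (fun _ => Set.subset_univ _) hR.2.1) hη
    have hVA := mul_le_mul_of_nonneg_left
      (hfv.tsum_le_variation hνnn hA (Set.subset_iUnion A) hAd) (by positivity : 0 ≤ 2 * M)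
    rw [Real.norm_eq_abs, abs_lt] at hflt hhlt
    rw [div_le_iff₀ (by positivity)]
    linarith [hflt.1, hhlt.2]

/-- Condition (E) makes the semivariation continuous along sequences decreasing to `∅`. -/
theorem ConditionE.exists_variation_lt (hfv : FiniteVariation ν) (hν0 : ν ∅ = 0)
    (hE : ConditionE (semivariation ν)) {C : ℕ → Set S} (hC : ∀ n, MeasurableSet (C n))
    (hanti : Antitone C) (hempty : ⋂ n, C n = ∅) {c : ℝ} (hc : 0 < c) :
    ∃ n, variation ν (C n) < c := by
  obtain ⟨np, mp, -, -, hlim⟩ := hE (fun _ => C) (fun _ => hC) (fun _ => hanti)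
    (by simpa [hempty] using hfv.semivariation_empty hν0)
  obtain ⟨k, hk⟩ := (hlim.eventually_lt_const hc).exists
  refine ⟨np k, (hfv.variation_le_semivariation ?_).trans_lt hk⟩
  exact Set.subset_iUnion₂_of_subset k le_rfl subset_rfl

end Variation

/-- Fatou-type theorem: `(|RL|)∫ liminf h_n dν ≤ liminf (|RL|)∫ h_n dν`
for a uniformly bounded sequence, when `ν` is monotone, of finite variation and `ν̃`
satisfies condition (E). -/
theorem absRL_fatou
    {S : Type*} [Nonempty S] [MeasurableSpace S]
    (ν : Set S → ℝ) (hν0 : ν ∅ = 0) (hνnn : ∀ A : Set S, MeasurableSet A → 0 ≤ ν A)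
    (hmono : ∀ A B : Set S, MeasurableSet A → MeasurableSet B → A ⊆ B → ν A ≤ ν B)
    (hfv : FiniteVariation ν)
    (hE : ConditionE (semivariation ν))
    (hn : ℕ → S → ℝ)
    (hb : ∃ M : ℝ, ∀ (n : ℕ) (s : S), |hn n s| ≤ M)
    (an : ℕ → ℝ) (b : ℝ)
    (hhn : ∀ n : ℕ, AbsRL ν (hn n) Set.univ (an n))
    (hliminf : AbsRL ν (fun s => Filter.liminf (fun n => hn n s) Filter.atTop) Set.univ b) :
    b ≤ Filter.liminf an Filter.atTop := by
  obtain ⟨M₀, hM₀⟩ := hb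
  obtain ⟨M, hM0, hM⟩ : ∃ M : ℝ, 0 < M ∧ ∀ n s, |hn n s| ≤ M :=
    ⟨max M₀ 1, by positivity, fun n s => (hM₀ n s).trans (le_max_left _ _)⟩
  have hbelow : ∀ s, IsBoundedUnder (· ≥ ·) atTop fun n => hn n s := fun s =>
    isBoundedUnder_of ⟨-M, fun n => (abs_le.1 (hM n s)).1⟩
  have habove : ∀ s, IsBoundedUnder (· ≤ ·) atTop fun n => hn n s := fun s =>
    isBoundedUnder_of ⟨M, fun n => (abs_le.1 (hM n s)).2⟩
  set f : S → ℝ := fun s => liminf (fun n => hn n s) atTop with hf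
  have hfM : ∀ s, |f s| ≤ M := fun s => abs_le.2
    ⟨le_liminf_of_le (habove s).isCoboundedUnder_ge
      (Eventually.of_forall fun n => (abs_le.1 (hM n s)).1),
    liminf_le_of_le (hbelow s) fun x hx =>
      let ⟨n, h⟩ := hx.exists
      h.trans (abs_le.1 (hM n s)).2⟩
  have hanle : IsBoundedUnder (· ≤ ·) atTop an :=
    isBoundedUnder_of ⟨_, fun n => (hhn n).le_mul_variation hfv hνnn hM0.le (hM n)⟩
  by_contra! hlt
  obtain ⟨b', hb', hb'b⟩ := exists_between hlt
  have hfreq : ∃ᶠ n in atTop, an n < b' :=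
    frequently_lt_of_liminf_lt hanle.isCoboundedUnder_ge hb'
  have hV := hfv.variation_nonneg Set.univ
  have hδ : 0 < b - b' := sub_pos.2 hb'b
  obtain ⟨η, hη, hηδ⟩ : ∃ η : ℝ, 0 < η ∧ η * variation ν Set.univ ≤ (b - b') / 4 := by
    refine ⟨(b - b') / 4 / (variation ν Set.univ + 1), by positivity, ?_⟩
    rw [div_mul_eq_mul_div, div_le_iff₀ (by positivity)]
    nlinarith
  have hG : ∀ n, ∃ G, MeasurableSet G ∧ (∀ s ∈ G, η ≤ f s - hn n s) ∧
      (an n < b' → (b - b') / (8 * M) ≤ variation ν G) := by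
    intro n
    by_cases h : an n < b'
    · obtain ⟨G, hG, hGη, hGv⟩ := AbsRL.exists_measurableSet_le_sub hν0 hfv hνnn hM0 hfM (hM n)
        hliminf (hhn n) hδ (by linarith) hη.le hηδ
      exact ⟨G, hG, hGη, fun _ => hGv⟩
    · exact ⟨∅, MeasurableSet.empty, by simp, fun h' => (h h').elim⟩
  choose G hGm hGη hGv using hG
  obtain ⟨n, hsmall⟩ := hE.exists_variation_lt hfv hν0 (C := fun n => ⋃ k ≥ n, G k)
    (fun n => MeasurableSet.iUnion fun k => MeasurableSet.iUnion fun _ => hGm k)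
    (fun m n hmn => Set.biUnion_subset_biUnion_left fun k hk => le_trans hmn hk)
    (by
      refine Set.eq_empty_of_forall_notMem fun s hs => ?_
      obtain ⟨N, hN⟩ := eventually_atTop.1
        (eventually_lt_of_lt_liminf (show f s - η < f s by linarith) (hbelow s))
      obtain ⟨k, hk, hsk⟩ := Set.mem_iUnion₂.1 (Set.mem_iInter.1 hs N)
      linarith [hN k hk, hGη k s hsk])
    (show 0 < (b - b') / (8 * M) by positivity)
  obtain ⟨k, hk, hak⟩ := frequently_atTop.1 hfreq n
  exact ((hGv k hak).trans (hfv.variation_mono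
    (Set.subset_iUnion₂_of_subset k hk subset_rfl))).not_gt hsmall
end
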